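/- Let d ≥ 1 be an integer, σ ∈ (0, π/2), ρ > 0, s ∈ ℝ, and n ∈ ℕ. Then there exists a constant C = C(d, s, n, σ, ρ) > 0 such that for every complex number λ with λ ≠ 0 and |arg λ| < π − σ, and every x ∈ ℝ^d with x ≠ 0, one has ‖D^n(y ↦ A(y)^s)(x)‖ ≤ C · (|λ|^{1/2} + ‖x‖)^{s − n}, where A(y) = √(ρλ + ‖y‖²) ∈ ℂ and A(y)^s is the principal complex power. -/

import Mathlib

open Real

/-- The `n`-th derivative of `f` precomposed with the affine map `y ↦ p + L y`. -/
theorem norm_iteratedFDeriv_comp_add_clm_le {E F G : Type*}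
    [NormedAddCommGroup E] [NormedSpace ℝ E] [NormedAddCommGroup F] [NormedSpace ℝ F]
    [NormedAddCommGroup G] [NormedSpace ℝ G] {f : F → G} {U : Set F} (hU : IsOpen U) {n : ℕ}
    (hf : ContDiffOn ℝ n f U) (p : F) (L : E →L[ℝ] F) {x : E} (hx : p + L x ∈ U) :
    ‖iteratedFDeriv ℝ n (fun y => f (p + L y)) x‖ ≤
      ‖iteratedFDeriv ℝ n f (p + L x)‖ * ‖L‖ ^ n := by
  set V : Set F := (fun q => p + q) ⁻¹' U
  have hV : IsOpen V := hU.preimage (by fun_prop)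
  have hg : ContDiffOn ℝ n (fun q => f (p + q)) V :=
    hf.comp (by fun_prop) (fun q hq => hq)
  have hLV : IsOpen (L ⁻¹' V) := hV.preimage L.continuous
  have h1 := L.iteratedFDerivWithin_comp_right hg hV.uniqueDiffOn hLV.uniqueDiffOn
    (x := x) hx le_rfl
  rw [iteratedFDerivWithin_of_isOpen n hLV hx, iteratedFDerivWithin_of_isOpen n hV hx,
    iteratedFDeriv_comp_add_left] at h1
  have h2 := (iteratedFDeriv ℝ n f (p + L x)).norm_compContinuousLinearMap_le fun _ => L
  rw [← h1] at h2
  simpa [Function.comp_def] using h2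

namespace Complex

theorem ofReal_mul_add_sq_mem_slitPlane {ρ : ℝ} (hρ : 0 < ρ) {z : ℂ} (hz : z ∈ slitPlane)
    (b : ℝ) : (ρ : ℂ) * z + (b : ℂ) ^ 2 ∈ slitPlane := by
  rw [mem_slitPlane_iff] at *
  simp only [← ofReal_pow, add_re, add_im, re_ofReal_mul, im_ofReal_mul, ofReal_re, ofReal_im,
    add_zero]
  rcases hz with h | h
  · left; positivity
  · right; positivity

theorem cpow_half_cpow (z w : ℂ) : (z ^ ((1 : ℂ) / 2)) ^ w = z ^ ((1 : ℂ) / 2 * w) := by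
  have him : (log z * ((1 : ℂ) / 2)).im = z.arg / 2 := by
    rw [show (1 : ℂ) / 2 = ((1 / 2 : ℝ) : ℂ) by norm_num, im_mul_ofReal, log_im]; ring
  have h1 := neg_pi_lt_arg z
  have h2 := arg_le_pi z
  have h3 := Real.pi_pos
  rw [cpow_mul] <;> rw [him] <;> linarith

theorem ofReal_sq_mul_cpow_half_cpow {r : ℝ} (hr : 0 < r) {z : ℂ} (hz : z ≠ 0) (s : ℝ) :
    (((r : ℂ) ^ 2 * z) ^ ((1 : ℂ) / 2)) ^ (s : ℂ) =
      ((r ^ s : ℝ) : ℂ) * (z ^ ((1 : ℂ) / 2)) ^ (s : ℂ) := by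
  have hr' : (r : ℂ) ≠ 0 := ofReal_ne_zero.2 hr.ne'
  rw [cpow_half_cpow, cpow_half_cpow, ofReal_cpow hr.le, cpow_def_of_ne_zero hr',
    cpow_def_of_ne_zero hz, cpow_def_of_ne_zero (by positivity), ← ofReal_pow,
    log_ofReal_mul (by positivity) hz, Real.log_pow, ← exp_add, ofReal_mul, ofReal_log hr.le]
  congr 1
  push_cast
  ring

end Complex

/-- `(μ, y) ↦ (ρμ + ‖y‖²)^{1/2·s}` is smooth where the base avoids the nonpositive reals. -/
theorem contDiffOn_cpow_half_cpow {E : Type*} [NormedAddCommGroup E] [InnerProductSpace ℝ E]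
    (ρ s : ℝ) (n : ℕ) :
    ContDiffOn ℝ n
      (fun p : ℂ × E => (((ρ : ℂ) * p.1 + (‖p.2‖ : ℂ) ^ 2) ^ ((1 : ℂ) / 2)) ^ (s : ℂ))
      {p | (ρ : ℂ) * p.1 + (‖p.2‖ : ℂ) ^ 2 ∈ Complex.slitPlane} := by
  intro p hp
  have h1 : ContDiffAt ℝ n (fun z : ℂ => (z ^ ((1 : ℂ) / 2)) ^ (s : ℂ))
      ((ρ : ℂ) * p.1 + (‖p.2‖ : ℂ) ^ 2) := by
    simp only [Complex.cpow_half_cpow]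
    exact ((analyticAt_id.cpow analyticAt_const hp).contDiffAt).restrict_scalars ℝ
  have h2 : ContDiff ℝ n (fun p : ℂ × E => (ρ : ℂ) * p.1 + (‖p.2‖ : ℂ) ^ 2) := by
    simp only [← Complex.ofReal_pow]
    refine (contDiff_const.mul contDiff_fst).add ?_
    exact Complex.ofRealCLM.contDiff.comp (contDiff_snd.norm_sq ℝ)
  exact (h1.comp p h2.contDiffAt).contDiffWithinAt

/-- The pairs `(a²e^{iθ}, u)` with `|θ| ≤ t`, `a ≥ 0` and `a + ‖u‖ = 1`. -/
def sectorSphere (E : Type*) [NormedAddCommGroup E] (t : ℝ) : Set (ℂ × E) :=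
  (fun q : ℝ × ℝ × E => ((q.1 : ℂ) ^ 2 * Complex.exp (q.2.1 * Complex.I), q.2.2)) ''
    ((Set.Icc 0 1 ×ˢ Set.Icc (-t) t ×ˢ Metric.closedBall 0 1) ∩ {q | q.1 + ‖q.2.2‖ = 1})

theorem isCompact_sectorSphere (E : Type*) [NormedAddCommGroup E] [ProperSpace E] (t : ℝ) :
    IsCompact (sectorSphere E t) := by
  refine IsCompact.image ?_ (by fun_prop)
  refine (isCompact_Icc.prod (isCompact_Icc.prod (isCompact_closedBall 0 1))).inter_right ?_
  exact isClosed_eq (by fun_prop) (by fun_prop)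

theorem sectorSphere_subset {E : Type*} [NormedAddCommGroup E] {ρ t : ℝ} (hρ : 0 < ρ)
    (ht : t < π) :
    sectorSphere E t ⊆ {p | (ρ : ℂ) * p.1 + (‖p.2‖ : ℂ) ^ 2 ∈ Complex.slitPlane} := by
  rintro _ ⟨⟨a, θ, u⟩, ⟨⟨ha, hθ, -⟩, hau⟩, rfl⟩
  simp only [Set.mem_ofPred_eq, Set.mem_Icc] at ha hθ hau ⊢
  rcases ha.1.eq_or_lt with rfl | ha0
  · have : ‖u‖ = 1 := by linarith
    simp [this]
  · refine Complex.ofReal_mul_add_sq_mem_slitPlane hρ ?_ _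
    rw [Complex.mem_slitPlane_iff_arg, ← Complex.ofReal_pow, Complex.arg_real_mul _ (by positivity),
      Complex.arg_exp_mul_I, (toIocMod_eq_self _).2 ⟨by linarith, by linarith⟩]
    refine ⟨by linarith, mul_ne_zero ?_ (Complex.exp_ne_zero _)⟩
    exact_mod_cast (by positivity : a ^ 2 ≠ 0)

theorem mem_sectorSphere {E : Type*} [NormedAddCommGroup E] [NormedSpace ℝ E] {t R : ℝ}
    {lam : ℂ} {x : E} (harg : |lam.arg| ≤ t) (hR : 0 < R)
    (hRx : ‖lam‖ ^ ((1 : ℝ) / 2) + ‖x‖ = R) :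
    ((R : ℂ)⁻¹ ^ 2 * lam, R⁻¹ • x) ∈ sectorSphere E t := by
  have h0 : 0 ≤ ‖lam‖ ^ ((1 : ℝ) / 2) := by positivity
  have hsq : (‖lam‖ ^ ((1 : ℝ) / 2)) ^ 2 = ‖lam‖ := by
    rw [← Real.sqrt_eq_rpow, Real.sq_sqrt (norm_nonneg _)]
  have hu : ‖R⁻¹ • x‖ = R⁻¹ * ‖x‖ := by rw [norm_smul, Real.norm_of_nonneg (by positivity)]
  have hsum : R⁻¹ * ‖lam‖ ^ ((1 : ℝ) / 2) + R⁻¹ * ‖x‖ = 1 := by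
    rw [← mul_add, hRx, inv_mul_cancel₀ hR.ne']
  have h1 : 0 ≤ R⁻¹ * ‖x‖ := by positivity
  have h2 : 0 ≤ R⁻¹ * ‖lam‖ ^ ((1 : ℝ) / 2) := by positivity
  refine ⟨(R⁻¹ * ‖lam‖ ^ ((1 : ℝ) / 2), lam.arg, R⁻¹ • x),
    ⟨⟨⟨h2, by dsimp only; linarith⟩, abs_le.1 harg, ?_⟩, ?_⟩, ?_⟩
  · rw [mem_closedBall_zero_iff]; dsimp only; linarith
  · show _ + ‖R⁻¹ • x‖ = 1
    rw [hu, hsum]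
  · refine Prod.ext ?_ rfl
    dsimp only
    rw [← Complex.ofReal_pow, mul_pow, hsq]
    push_cast
    rw [mul_assoc, Complex.norm_mul_exp_arg_mul_I]

/-- Lemma 2.2(1), first estimate: derivative bounds for `y ↦ A(y)^s`,
`A(y) = √(ρλ + ‖y‖²)` (principal complex square root / power). -/
theorem stmt_1 (d : ℕ) (hd : 1 ≤ d) (σ : ℝ) (hσ : σ ∈ Set.Ioo 0 (π / 2))
    (ρ : ℝ) (hρ : 0 < ρ) (s : ℝ) (n : ℕ) :
    ∃ C : ℝ, 0 < C ∧ ∀ lam : ℂ, lam ≠ 0 → |lam.arg| < π - σ →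
      ∀ x : EuclideanSpace ℝ (Fin d), x ≠ 0 →
        ‖iteratedFDeriv ℝ n
            (fun y : EuclideanSpace ℝ (Fin d) =>
              (((ρ : ℂ) * lam + (‖y‖ : ℂ) ^ 2) ^ ((1 : ℂ) / 2)) ^ (s : ℂ)) x‖ ≤
          C * (‖lam‖ ^ ((1 : ℝ) / 2) + ‖x‖) ^ (s - n) := by
  set E := EuclideanSpace ℝ (Fin d)
  set Φ : ℂ × E → ℂ :=
    fun p => (((ρ : ℂ) * p.1 + (‖p.2‖ : ℂ) ^ 2) ^ ((1 : ℂ) / 2)) ^ (s : ℂ)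
  set U : Set (ℂ × E) := {p | (ρ : ℂ) * p.1 + (‖p.2‖ : ℂ) ^ 2 ∈ Complex.slitPlane}
  have hU : IsOpen U := Complex.isOpen_slitPlane.preimage (by fun_prop)
  have hΦU : ContDiffOn ℝ n Φ U := contDiffOn_cpow_half_cpow ρ s n
  have hKU : sectorSphere E (π - σ) ⊆ U := sectorSphere_subset hρ (by linarith [hσ.1])
  have hcont : ContinuousOn (iteratedFDeriv ℝ n Φ) U :=
    (hΦU.continuousOn_iteratedFDerivWithin le_rfl hU.uniqueDiffOn).congr
      (iteratedFDerivWithin_of_isOpen n hU).symm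
  obtain ⟨M, hM⟩ := (isCompact_sectorSphere E (π - σ)).exists_bound_of_continuousOn
    (hcont.mono hKU)
  refine ⟨max M 1, by positivity, fun lam hlam harg x _ => ?_⟩
  set R := ‖lam‖ ^ ((1 : ℝ) / 2) + ‖x‖ with hRdef
  have hR : 0 < R := by positivity
  have hRc : (R : ℂ) ≠ 0 := Complex.ofReal_ne_zero.2 hR.ne'
  have hmem := mem_sectorSphere harg.le hR hRdef.symm
  set p : ℂ × E := ((R : ℂ)⁻¹ ^ 2 * lam, 0) with hp
  set L : E →L[ℝ] ℂ × E := R⁻¹ • ContinuousLinearMap.inr ℝ ℂ E with hL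
  have hpL (y : E) : p + L y = ((R : ℂ)⁻¹ ^ 2 * lam, R⁻¹ • y) := by simp [hp, hL]
  have hslit : lam ∈ Complex.slitPlane := by
    refine Complex.mem_slitPlane_iff_arg.2 ⟨fun h => ?_, hlam⟩
    rw [h, abs_of_pos pi_pos] at harg
    linarith [hσ.1]
  have hfun : (fun y : E => (((ρ : ℂ) * lam + (‖y‖ : ℂ) ^ 2) ^ ((1 : ℂ) / 2)) ^ (s : ℂ)) =
      (R ^ s) • fun y => Φ (p + L y) := by
    funext y
    have key : (ρ : ℂ) * lam + (‖y‖ : ℂ) ^ 2 =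
        (R : ℂ) ^ 2 * ((ρ : ℂ) * ((R : ℂ)⁻¹ ^ 2 * lam) + (‖R⁻¹ • y‖ : ℂ) ^ 2) := by
      rw [norm_smul, Real.norm_of_nonneg (by positivity)]
      push_cast
      field_simp
    have hne := Complex.slitPlane_ne_zero
      (Complex.ofReal_mul_add_sq_mem_slitPlane hρ hslit ‖y‖)
    rw [key] at hne ⊢
    rw [Complex.ofReal_sq_mul_cpow_half_cpow hR (right_ne_zero_of_mul hne), Pi.smul_apply, hpL,
      Complex.real_smul]
  have hLn : ‖L‖ ≤ R⁻¹ := by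
    rw [hL, norm_smul, Real.norm_of_nonneg (by positivity)]
    exact mul_le_of_le_one_right (by positivity) (ContinuousLinearMap.norm_inr_le_one ℝ ℂ E)
  have hxU : p + L x ∈ U := by rw [hpL]; exact hKU hmem
  have hsmooth : ContDiffAt ℝ n (fun y => Φ (p + L y)) x :=
    ContDiffAt.comp x (hΦU.contDiffAt (hU.mem_nhds hxU)) (by fun_prop)
  rw [hfun, iteratedFDeriv_const_smul_apply hsmooth, norm_smul,
    Real.norm_of_nonneg (by positivity)]
  calc R ^ s * ‖iteratedFDeriv ℝ n (fun y => Φ (p + L y)) x‖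
      ≤ R ^ s * (max M 1 * R⁻¹ ^ n) := by
        gcongr
        refine (norm_iteratedFDeriv_comp_add_clm_le hU hΦU p L hxU).trans ?_
        gcongr
        rw [hpL]
        exact (hM _ hmem).trans (le_max_left _ _)
    _ = max M 1 * R ^ (s - n) := by
        rw [Real.rpow_sub hR, Real.rpow_natCast, inv_pow]
        ring
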